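/- Let γ_{1,2,2} be the permutation of {1,…,6} whose one-line notation is 6, 4, 3, 5, 2, 1. Then for all n ≥ 3, |S_n(132, 123, γ_{1,2,2})| = F_{n+3} + F_{n+1} − 3n + 2, where F_m denotes the m-th Fibonacci number. -/

import Mathlib

/-- `π` contains `σ` as a pattern: there is a subsequence of `π` (in one-line notation)
whose entries are in the same relative order as those of `σ`. -/
def PContains {n k : ℕ} (π : Equiv.Perm (Fin n)) (σ : Equiv.Perm (Fin k)) : Prop :=
  ∃ f : Fin k → Fin n, StrictMono f ∧ ∀ s t : Fin k, π (f s) < π (f t) ↔ σ s < σ t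

/-- `π` avoids the pattern `σ`. -/
def PAvoids {n k : ℕ} (π : Equiv.Perm (Fin n)) (σ : Equiv.Perm (Fin k)) : Prop :=
  ¬ PContains π σ

/-- The pattern 123 (the identity permutation of `{1,2,3}`). -/
def p123 : Equiv.Perm (Fin 3) := Equiv.refl (Fin 3)

/-- The pattern 132 (one-line notation `1,3,2`, zero-indexed `0,2,1`). -/
noncomputable def p132 : Equiv.Perm (Fin 3) := Equiv.ofBijective ![0, 2, 1] (by decide)

/-- The pattern `γ_{1,2,2}` with one-line notation `6,4,3,5,2,1`
(zero-indexed `5,3,2,4,1,0`). -/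
noncomputable def g122 : Equiv.Perm (Fin 6) :=
  Equiv.ofBijective ![5, 3, 2, 4, 1, 0] (by decide)

open Equiv

/-- Every entry of `π` has at most one larger entry to its right. -/
def AtMostOneLarger {n : ℕ} (π : Perm (Fin n)) : Prop :=
  ∀ i j k, i < j → j < k → ¬ (π i < π j ∧ π i < π k)

/-- `π` contains `6, 4, 3, 5, 2, 1`. -/
def Has643521 {n : ℕ} (π : Perm (Fin n)) : Prop :=
  ∃ z a b c d e, z < a ∧ a < b ∧ b < c ∧ c < d ∧ d < e ∧
    π e < π d ∧ π d < π b ∧ π b < π a ∧ π a < π c ∧ π c < π z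

/-- `π` contains `4, 3, 5, 2, 1`. -/
def Has43521 {n : ℕ} (π : Perm (Fin n)) : Prop :=
  ∃ a b c d e, a < b ∧ b < c ∧ c < d ∧ d < e ∧
    π e < π d ∧ π d < π b ∧ π b < π a ∧ π a < π c

/-- `π` contains `3, 4, 2, 1` with its maximum playing the role of `4`. -/
def HasTop3421 {n : ℕ} (π : Perm (Fin (n + 1))) : Prop :=
  ∃ b c d e, b < c ∧ c < d ∧ d < e ∧ π e < π d ∧ π d < π b ∧ π c = Fin.last n

/-- Two entries to the right of the maximum of `π` are in decreasing order. -/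
def HasTop321 {n : ℕ} (π : Perm (Fin (n + 1))) : Prop :=
  ∃ c d e, c < d ∧ d < e ∧ π e < π d ∧ π c = Fin.last n

/-- `π` contains `2, 1`. -/
def Has21 {n : ℕ} (π : Perm (Fin n)) : Prop :=
  ∃ d e, d < e ∧ π e < π d

/-- The permutation with first entry `p` whose other entries are ordered as in `σ`. -/
def consPerm {n : ℕ} (p : Fin (n + 1)) (σ : Perm (Fin n)) : Perm (Fin (n + 1)) :=
  ((finSuccEquiv' 0).trans (optionCongr σ)).trans (finSuccEquiv' p).symm

section consPerm

variable {n : ℕ}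

@[simp]
lemma consPerm_zero (p : Fin (n + 1)) (σ : Perm (Fin n)) : consPerm p σ 0 = p := by
  simp [consPerm]

@[simp]
lemma consPerm_succ (p : Fin (n + 1)) (σ : Perm (Fin n)) (i : Fin n) :
    consPerm p σ i.succ = p.succAbove (σ i) := by
  have h : finSuccEquiv' (0 : Fin (n + 1)) i.succ = some i := by
    rw [← Fin.succAbove_zero, finSuccEquiv'_succAbove]
  simp [consPerm, h]

lemma consPerm_injective :
    Function.Injective fun x : Fin (n + 1) × Perm (Fin n) => consPerm x.1 x.2 := by
  rintro ⟨p, σ⟩ ⟨q, τ⟩ h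
  have hpq : p = q := by simpa using congrArg (· 0) h
  subst hpq
  have : σ = τ := by
    ext i
    have := congrArg (· i.succ) h
    simp only [consPerm_succ, Fin.succAbove_right_inj] at this
    rw [this]
  rw [this]

lemma exists_consPerm (π : Perm (Fin (n + 1))) : ∃ p σ, consPerm p σ = π := by
  have hbij := (Fintype.bijective_iff_injective_and_card
    fun x : Fin (n + 1) × Perm (Fin n) => consPerm x.1 x.2).2
      ⟨consPerm_injective, by simp [Fintype.card_perm, Nat.factorial_succ]⟩
  obtain ⟨⟨p, σ⟩, h⟩ := hbij.2 π
  exact ⟨p, σ, h⟩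

lemma last_succAbove_lt (x : Fin n) : (Fin.last n).succAbove x < Fin.last n := by
  simp [Fin.castSucc_lt_last]

lemma not_last_lt (x : Fin (n + 1)) : ¬ Fin.last n < x := not_lt.2 (Fin.le_last x)

lemma second_succAbove_lt_iff (x : Fin (n + 1)) :
    (Fin.last n).castSucc.succAbove x < (Fin.last n).castSucc ↔ x ≠ Fin.last n := by
  rw [Fin.succAbove_lt_iff_castSucc_lt, Fin.castSucc_lt_castSucc_iff, Fin.lt_last_iff_ne_last]

lemma second_lt_succAbove_iff (x : Fin (n + 1)) :
    (Fin.last n).castSucc < (Fin.last n).castSucc.succAbove x ↔ x = Fin.last n := by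
  rw [Fin.lt_succAbove_iff_le_castSucc, Fin.castSucc_le_castSucc_iff, Fin.last_le_iff]

lemma second_succAbove_eq_last_iff (x : Fin (n + 1)) :
    (Fin.last n).castSucc.succAbove x = Fin.last (n + 1) ↔ x = Fin.last n := by
  constructor
  · intro h
    rw [← second_lt_succAbove_iff, h]
    exact Fin.castSucc_lt_last _
  · rintro rfl
    simp

lemma second_ne_last : (Fin.last n).castSucc ≠ Fin.last (n + 1) :=
  (Fin.castSucc_lt_last _).ne

lemma atMostOneLarger_consLast (σ : Perm (Fin n)) :
    AtMostOneLarger (consPerm (Fin.last n) σ) ↔ AtMostOneLarger σ := by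
  simp only [AtMostOneLarger, Fin.forall_fin_succ, consPerm_zero, consPerm_succ,
    Fin.succAbove_lt_succAbove_iff, Fin.succ_lt_succ_iff, not_last_lt, Fin.not_lt_zero,
    false_and, not_false_eq_true, implies_true, false_implies, true_and]

lemma atMostOneLarger_consSecond (σ : Perm (Fin (n + 1))) :
    AtMostOneLarger (consPerm (Fin.last n).castSucc σ) ↔ AtMostOneLarger σ := by
  simp only [AtMostOneLarger, Fin.forall_fin_succ (n := n + 1), consPerm_zero, consPerm_succ,
    Fin.succAbove_lt_succAbove_iff, Fin.succ_lt_succ_iff, second_lt_succAbove_iff,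
    Fin.not_lt_zero, Fin.succ_pos, implies_true, false_implies, true_and,
    true_implies]
  refine and_iff_right ?_
  rintro i j hij ⟨hi, hj⟩
  exact hij.ne (σ.injective (hi.trans hj.symm))

lemma has43521_consLast (σ : Perm (Fin n)) :
    Has43521 (consPerm (Fin.last n) σ) ↔ Has43521 σ := by
  simp only [Has43521, Fin.exists_fin_succ, consPerm_zero, consPerm_succ,
    Fin.succAbove_lt_succAbove_iff, Fin.succ_lt_succ_iff, not_last_lt, Fin.not_lt_zero,
    false_and, and_false, exists_false, false_or]

lemma has643521_consLast (σ : Perm (Fin n)) :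
    Has643521 (consPerm (Fin.last n) σ) ↔ Has43521 σ := by
  simp only [Has643521, Fin.exists_fin_succ, consPerm_zero, consPerm_succ,
    Fin.succAbove_lt_succAbove_iff, Fin.succ_lt_succ_iff, not_last_lt, Fin.not_lt_zero,
    false_and, and_false, exists_false, false_or, last_succAbove_lt,
    Fin.succ_pos, true_and, and_true]
  refine or_iff_left_of_imp ?_
  rintro ⟨z, a, b, c, d, e, -, h1, h2, h3, h4, g1, g2, g3, g4, -⟩
  exact ⟨a, b, c, d, e, h1, h2, h3, h4, g1, g2, g3, g4⟩

lemma has43521_consSecond (σ : Perm (Fin (n + 1))) :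
    Has43521 (consPerm (Fin.last n).castSucc σ) ↔ HasTop3421 σ ∨ Has43521 σ := by
  simp only [Has43521, HasTop3421, Fin.exists_fin_succ (n := n + 1), consPerm_zero,
    consPerm_succ, Fin.succAbove_lt_succAbove_iff, Fin.succ_lt_succ_iff, Fin.not_lt_zero,
    false_and, and_false, exists_false, false_or,
    second_succAbove_lt_iff, second_lt_succAbove_iff, Fin.succ_pos, true_and]
  refine or_congr_left ⟨?_, ?_⟩
  · rintro ⟨b, c, d, e, h1, h2, h3, g1, g2, -, g3⟩
    exact ⟨b, c, d, e, h1, h2, h3, g1, g2, g3⟩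
  · rintro ⟨b, c, d, e, h1, h2, h3, g1, g2, g3⟩
    exact ⟨b, c, d, e, h1, h2, h3, g1, g2,
      fun h => h1.ne (σ.injective (h.trans g3.symm)), g3⟩

lemma not_hasTop3421_consLast (σ : Perm (Fin n)) :
    ¬ HasTop3421 (consPerm (Fin.last n) σ) := by
  simp only [HasTop3421, Fin.exists_fin_succ, consPerm_zero, consPerm_succ,
    Fin.not_lt_zero, false_and, and_false, exists_false, false_or, (last_succAbove_lt _).ne,
    or_false, not_false_eq_true]

lemma hasTop3421_consSecond (σ : Perm (Fin (n + 1))) :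
    HasTop3421 (consPerm (Fin.last n).castSucc σ) ↔ HasTop321 σ := by
  simp only [HasTop3421, HasTop321, Fin.exists_fin_succ (n := n + 1), consPerm_zero,
    consPerm_succ, Fin.succAbove_lt_succAbove_iff, Fin.succ_lt_succ_iff, Fin.not_lt_zero,
    false_and, and_false, exists_false, false_or,
    second_succAbove_lt_iff, second_succAbove_eq_last_iff, Fin.succ_pos, true_and]
  constructor
  · rintro (⟨c, d, e, h1, h2, g1, -, g2⟩ | ⟨b, c, d, e, -, h1, h2, g1, -, g2⟩) <;>
      exact ⟨c, d, e, h1, h2, g1, g2⟩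
  · rintro ⟨c, d, e, h1, h2, g1, g2⟩
    exact Or.inl ⟨c, d, e, h1, h2, g1, fun h => h1.ne (σ.injective (g2.trans h.symm)), g2⟩

lemma hasTop321_consLast (σ : Perm (Fin n)) :
    HasTop321 (consPerm (Fin.last n) σ) ↔ Has21 σ := by
  simp only [HasTop321, Has21, Fin.exists_fin_succ, consPerm_zero, consPerm_succ,
    Fin.succAbove_lt_succAbove_iff, Fin.succ_lt_succ_iff, Fin.not_lt_zero,
    false_and, and_false, exists_false, false_or, or_false, (last_succAbove_lt _).ne,
    Fin.succ_pos, true_and, and_true]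

lemma hasTop321_consSecond (σ : Perm (Fin (n + 1))) :
    HasTop321 (consPerm (Fin.last n).castSucc σ) ↔ HasTop321 σ := by
  simp only [HasTop321, Fin.exists_fin_succ (n := n + 1), consPerm_zero, consPerm_succ,
    Fin.succAbove_lt_succAbove_iff, Fin.succ_lt_succ_iff, Fin.not_lt_zero,
    false_and, and_false, exists_false, false_or, second_ne_last,
    second_succAbove_eq_last_iff]

lemma AtMostOneLarger.hasTop321 {σ : Perm (Fin (n + 1))} (hσ : AtMostOneLarger σ)
    (h : Has43521 σ) : HasTop321 σ := by
  obtain ⟨a, b, c, d, e, -, h2, h3, h4, g1, -, g3, g4⟩ := h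
  obtain ⟨m, hm⟩ := σ.surjective (Fin.last n)
  have hmc : m ≤ c := by
    by_contra! hcm
    exact hσ b c m h2 hcm
      ⟨g3.trans g4, (g3.trans g4).trans_le (hm ▸ Fin.le_last _)⟩
  exact ⟨m, d, e, hmc.trans_lt h3, h4, g1, hm⟩

lemma has43521_consSecond_consSecond {σ : Perm (Fin (n + 1))} (hσ : AtMostOneLarger σ) :
    Has43521 (consPerm (Fin.last (n + 1)).castSucc (consPerm (Fin.last n).castSucc σ)) ↔
      HasTop321 σ := by
  rw [has43521_consSecond, hasTop3421_consSecond]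
  refine or_iff_left_of_imp fun h => ?_
  rw [← hasTop321_consSecond]
  exact ((atMostOneLarger_consSecond σ).2 hσ).hasTop321 h

lemma has43521_consSecond_consLast (σ : Perm (Fin n)) :
    Has43521 (consPerm (Fin.last n).castSucc (consPerm (Fin.last n) σ)) ↔ Has43521 σ := by
  rw [has43521_consSecond, has43521_consLast, or_iff_right (not_hasTop3421_consLast σ)]

lemma has643521_consSecond {σ : Perm (Fin (n + 1))} (hσ : AtMostOneLarger σ) :
    Has643521 (consPerm (Fin.last n).castSucc σ) ↔ Has643521 σ := by
  simp only [Has643521, Fin.exists_fin_succ (n := n + 1), consPerm_zero,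
    consPerm_succ, Fin.succAbove_lt_succAbove_iff, Fin.succ_lt_succ_iff, Fin.not_lt_zero,
    false_and, and_false, exists_false, false_or,
    second_succAbove_lt_iff, Fin.succ_pos, true_and]
  refine or_iff_right_of_imp ?_
  rintro ⟨a, b, c, d, e, h1, h2, h3, h4, g1, g2, g3, g4, hc⟩
  obtain ⟨m, hm⟩ := σ.surjective (Fin.last n)
  have hcm : σ c < σ m := hm ▸ Fin.lt_last_iff_ne_last.2 hc
  refine ⟨m, a, b, c, d, e, ?_, h1, h2, h3, h4, g1, g2, g3, g4, hcm⟩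
  by_contra! ham
  have ham' : a < m := ham.lt_of_ne fun h => (g4.trans hcm).ne (congrArg σ h)
  rcases lt_trichotomy c m with h | h | h
  · exact hσ a c m (h1.trans h2) h ⟨g4, g4.trans hcm⟩
  · exact hcm.ne (congrArg σ h)
  · exact hσ a m c ham' h ⟨g4.trans hcm, g4⟩

lemma AtMostOneLarger.head {p : Fin (n + 2)} {σ : Perm (Fin (n + 1))}
    (h : AtMostOneLarger (consPerm p σ)) :
    p = Fin.last (n + 1) ∨ p = (Fin.last n).castSucc := by
  by_contra! hp
  obtain ⟨h1, h2⟩ := hp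
  obtain ⟨i, hi⟩ := (consPerm p σ).surjective (Fin.last (n + 1))
  obtain ⟨j, hj⟩ := (consPerm p σ).surjective (Fin.last n).castSucc
  have hpn : (p : ℕ) < n := by
    have := Fin.val_ne_iff.2 h1
    have := Fin.val_ne_iff.2 h2
    simp only [Fin.val_last, Fin.val_castSucc] at *
    omega
  have hp2 : p < (Fin.last n).castSucc := by simpa [Fin.lt_def] using hpn
  have hp1 : p < Fin.last (n + 1) := hp2.trans (Fin.castSucc_lt_last _)
  have hi0 : 0 < i := by
    refine Fin.pos_of_ne_zero ?_
    rintro rfl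
    exact h1 (by simpa using hi)
  have hj0 : 0 < j := by
    refine Fin.pos_of_ne_zero ?_
    rintro rfl
    exact h2 (by simpa using hj)
  have hij : i ≠ j := by
    rintro rfl
    exact second_ne_last (hj.symm.trans hi)
  rcases hij.lt_or_gt with hij | hij
  · exact h 0 i j hi0 hij ⟨by simpa only [consPerm_zero, hi], by simpa only [consPerm_zero, hj]⟩
  · exact h 0 j i hj0 hij ⟨by simpa only [consPerm_zero, hj], by simpa only [consPerm_zero, hi]⟩

end consPerm

section counting

variable {n : ℕ}

lemma card_eq_consLast_add_consSecond (P : Perm (Fin (n + 2)) → Prop) :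
    Nat.card {π // AtMostOneLarger π ∧ P π} =
      Nat.card {σ // AtMostOneLarger σ ∧ P (consPerm (Fin.last (n + 1)) σ)} +
      Nat.card {σ // AtMostOneLarger σ ∧ P (consPerm (Fin.last n).castSucc σ)} := by
  rw [← Nat.card_sum]
  refine (Nat.card_congr (Equiv.ofBijective (Sum.elim
    (fun σ => ⟨consPerm (Fin.last (n + 1)) σ.1, (atMostOneLarger_consLast _).2 σ.2.1, σ.2.2⟩)
    (fun σ => ⟨consPerm (Fin.last n).castSucc σ.1,
      (atMostOneLarger_consSecond _).2 σ.2.1, σ.2.2⟩)) ⟨?_, ?_⟩)).symm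
  · rintro (⟨σ, hσ⟩ | ⟨σ, hσ⟩) (⟨τ, hτ⟩ | ⟨τ, hτ⟩) h <;>
      have h' := Prod.ext_iff.1 (consPerm_injective (a₁ := (_, _)) (a₂ := (_, _))
        (Subtype.ext_iff.1 h))
    · simpa using h'.2
    · exact absurd h'.1.symm second_ne_last
    · exact absurd h'.1 second_ne_last
    · simpa using h'.2
  · rintro ⟨π, hπ, hP⟩
    obtain ⟨p, σ, rfl⟩ := exists_consPerm π
    rcases hπ.head with rfl | rfl
    · exact ⟨Sum.inl ⟨σ, (atMostOneLarger_consLast _).1 hπ, hP⟩, rfl⟩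
    · exact ⟨Sum.inr ⟨σ, (atMostOneLarger_consSecond _).1 hπ, hP⟩, rfl⟩

lemma card_congr_of_atMostOneLarger {P Q : Perm (Fin n) → Prop}
    (h : ∀ σ, AtMostOneLarger σ → (P σ ↔ Q σ)) :
    Nat.card {σ // AtMostOneLarger σ ∧ P σ} = Nat.card {σ // AtMostOneLarger σ ∧ Q σ} :=
  Nat.card_congr (Equiv.subtypeEquivRight fun σ => and_congr_right (h σ))

lemma card_perm_fin_one {P : Perm (Fin 1) → Prop} (h : ∀ σ, P σ) :
    Nat.card {σ // AtMostOneLarger σ ∧ P σ} = 1 := by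
  have : ∀ σ : Perm (Fin 1), AtMostOneLarger σ ∧ P σ :=
    fun σ => ⟨fun i j _ hij => absurd hij (by simp [Subsingleton.elim i j]), h σ⟩
  rw [Nat.card_congr (Equiv.subtypeUnivEquiv this)]
  simp

/-- The number of `123`- and `132`-avoiders that avoid `643521`. -/
noncomputable def cardAvoid643521 (n : ℕ) : ℕ :=
  Nat.card {π : Perm (Fin n) // AtMostOneLarger π ∧ ¬ Has643521 π}

/-- The number of `123`- and `132`-avoiders that avoid `43521`. -/
noncomputable def cardAvoid43521 (n : ℕ) : ℕ :=
  Nat.card {π : Perm (Fin n) // AtMostOneLarger π ∧ ¬ Has43521 π}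

/-- The number of `123`- and `132`-avoiders of length `n + 1` that increase after their
maximum. -/
noncomputable def cardAvoidTop321 (n : ℕ) : ℕ :=
  Nat.card {π : Perm (Fin (n + 1)) // AtMostOneLarger π ∧ ¬ HasTop321 π}

lemma cardAvoid643521_add_two (n : ℕ) :
    cardAvoid643521 (n + 2) = cardAvoid43521 (n + 1) + cardAvoid643521 (n + 1) := by
  unfold cardAvoid643521 cardAvoid43521
  rw [card_eq_consLast_add_consSecond]
  congr 1
  · exact card_congr_of_atMostOneLarger fun σ _ => not_congr (has643521_consLast σ)
  · exact card_congr_of_atMostOneLarger fun σ hσ => not_congr (has643521_consSecond hσ)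

lemma cardAvoid43521_add_three (n : ℕ) :
    cardAvoid43521 (n + 3) =
      cardAvoid43521 (n + 2) + (cardAvoid43521 (n + 1) + cardAvoidTop321 n) := by
  unfold cardAvoid43521 cardAvoidTop321
  rw [card_eq_consLast_add_consSecond, card_eq_consLast_add_consSecond (n := n)
    fun σ => ¬ Has43521 (consPerm (Fin.last (n + 1)).castSucc σ)]
  congr 1
  · exact card_congr_of_atMostOneLarger fun σ _ => not_congr (has43521_consLast σ)
  congr 1
  · exact card_congr_of_atMostOneLarger fun σ _ => not_congr (has43521_consSecond_consLast σ)
  · exact card_congr_of_atMostOneLarger fun σ hσ =>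
      not_congr (has43521_consSecond_consSecond hσ)

lemma eq_one_of_not_has21 {σ : Perm (Fin n)} (h : ¬ Has21 σ) : σ = 1 := by
  have hmono : StrictMono σ := fun i j hij => by
    by_contra! hle
    exact h ⟨i, j, hij, hle.lt_of_ne fun he => hij.ne' (σ.injective he)⟩
  have : (hmono.orderIsoOfSurjective σ σ.surjective) = OrderIso.refl _ := Subsingleton.elim _ _
  ext i
  exact congrArg (fun f : Fin n ≃o Fin n => (f i : ℕ)) this

lemma card_atMostOneLarger_not_has21 (n : ℕ) :
    Nat.card {π : Perm (Fin n) // AtMostOneLarger π ∧ ¬ Has21 π} = if n ≤ 2 then 1 else 0 := by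
  split_ifs with hn
  · refine Nat.card_eq_one_iff_exists.2 ⟨⟨1, ?_, ?_⟩, fun σ => ?_⟩
    · intro i j k hij hjk
      simp only [Fin.lt_def] at hij hjk
      omega
    · rintro ⟨d, e, hde, hed⟩
      exact hde.asymm hed
    · exact Subtype.ext (eq_one_of_not_has21 σ.2.2)
  · rw [Nat.card_eq_zero]
    refine Or.inl ⟨fun ⟨σ, hσ, h⟩ => ?_⟩
    obtain rfl := eq_one_of_not_has21 h
    exact hσ ⟨0, by omega⟩ ⟨1, by omega⟩ ⟨2, by omega⟩ (by simp) (by simp) (by simp)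

lemma cardAvoidTop321_succ (n : ℕ) :
    cardAvoidTop321 (n + 1) = (if n ≤ 1 then 1 else 0) + cardAvoidTop321 n := by
  unfold cardAvoidTop321
  rw [card_eq_consLast_add_consSecond]
  congr 1
  · rw [card_congr_of_atMostOneLarger fun σ _ => not_congr (hasTop321_consLast σ),
      card_atMostOneLarger_not_has21]
    simp
  · exact card_congr_of_atMostOneLarger fun σ _ => not_congr (hasTop321_consSecond σ)

lemma cardAvoidTop321_zero : cardAvoidTop321 0 = 1 := by
  refine card_perm_fin_one fun σ => ?_
  rintro ⟨c, d, e, h, -⟩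
  omega

lemma cardAvoidTop321_add_two (n : ℕ) : cardAvoidTop321 (n + 2) = 3 := by
  induction n with
  | zero => simp [cardAvoidTop321_succ, cardAvoidTop321_zero]
  | succ n ih => rw [cardAvoidTop321_succ, ih]; simp

lemma cardAvoid643521_one : cardAvoid643521 1 = 1 := by
  refine card_perm_fin_one fun σ => ?_
  rintro ⟨z, a, b, c, d, e, h, -⟩
  exact h.ne (Subsingleton.elim _ _)

lemma cardAvoid43521_one : cardAvoid43521 1 = 1 := by
  refine card_perm_fin_one fun σ => ?_
  rintro ⟨a, b, c, d, e, h, -⟩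
  exact h.ne (Subsingleton.elim _ _)

lemma cardAvoid43521_two : cardAvoid43521 2 = 2 := by
  unfold cardAvoid43521
  rw [card_eq_consLast_add_consSecond (n := 0)]
  have h : ∀ π : Perm (Fin 2), ¬ Has43521 π := by
    rintro π ⟨a, b, c, d, e, h1, h2, -⟩
    omega
  rw [card_perm_fin_one fun _ => h _, card_perm_fin_one fun _ => h _]

lemma cardAvoid43521_add_three_eq (n : ℕ) :
    cardAvoid43521 (n + 3) + 3 = Nat.fib (n + 5) + Nat.fib (n + 3) := by
  have h3 : cardAvoid43521 3 = 4 := by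
    rw [cardAvoid43521_add_three, cardAvoid43521_two, cardAvoid43521_one, cardAvoidTop321_zero]
  induction n using Nat.twoStepInduction with
  | zero => rw [h3]; rfl
  | one =>
    rw [cardAvoid43521_add_three 1, h3, cardAvoid43521_two, cardAvoidTop321_succ,
      cardAvoidTop321_zero]
    rfl
  | more n ih1 ih2 =>
    rw [cardAvoid43521_add_three (n + 2), cardAvoidTop321_add_two]
    have e1 : Nat.fib (n + 2 + 5) = Nat.fib (n + 5) + Nat.fib (n + 1 + 5) := Nat.fib_add_two
    have e2 : Nat.fib (n + 2 + 3) = Nat.fib (n + 3) + Nat.fib (n + 1 + 3) := Nat.fib_add_two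
    have e3 : cardAvoid43521 (n + 2 + 2) = cardAvoid43521 (n + 1 + 3) := rfl
    have e4 : cardAvoid43521 (n + 2 + 1) = cardAvoid43521 (n + 3) := rfl
    omega

lemma cardAvoid643521_add_three_eq (n : ℕ) :
    cardAvoid643521 (n + 3) + 3 * (n + 3) = Nat.fib (n + 6) + Nat.fib (n + 4) + 2 := by
  induction n with
  | zero =>
    rw [cardAvoid643521_add_two 1, cardAvoid43521_two, cardAvoid643521_add_two 0,
      cardAvoid43521_one, cardAvoid643521_one]
    rfl
  | succ n ih =>
    have h : cardAvoid643521 (n + 1 + 3) = cardAvoid43521 (n + 3) + cardAvoid643521 (n + 3) :=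
      cardAvoid643521_add_two (n + 2)
    have h' := cardAvoid43521_add_three_eq n
    have e1 : Nat.fib (n + 1 + 6) = Nat.fib (n + 5) + Nat.fib (n + 6) := Nat.fib_add_two
    have e2 : Nat.fib (n + 1 + 4) = Nat.fib (n + 3) + Nat.fib (n + 4) := Nat.fib_add_two
    omega

end counting

section patterns

variable {n : ℕ}

lemma pAvoids_p132_and_p123_iff (π : Perm (Fin n)) :
    PAvoids π p132 ∧ PAvoids π p123 ↔ AtMostOneLarger π := by
  have hmono : ∀ i j k : Fin n, i < j → j < k → StrictMono ![i, j, k] := by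
    intro i j k hij hjk
    rw [Fin.strictMono_iff_lt_succ]
    simp [Fin.forall_fin_succ, hij, hjk]
  constructor
  · rintro ⟨h1, h2⟩ i j k hij hjk ⟨h3, h4⟩
    rcases lt_trichotomy (π j) (π k) with h | h | h
    · refine h2 ⟨![i, j, k], hmono i j k hij hjk, ?_⟩
      simp [Fin.forall_fin_succ, p123, h, h3, h4, h.le, h3.le, h4.le]
    · exact hjk.ne (π.injective h)
    · refine h1 ⟨![i, j, k], hmono i j k hij hjk, ?_⟩
      simp [Fin.forall_fin_succ, p132, h, h3, h4, h.le, h3.le, h4.le]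
  · intro h
    constructor
    · rintro ⟨f, hf, hσ⟩
      exact h (f 0) (f 1) (f 2) (hf (by decide)) (hf (by decide))
        ⟨(hσ 0 1).2 (by simp [p132]), (hσ 0 2).2 (by simp [p132])⟩
    · rintro ⟨f, hf, hσ⟩
      exact h (f 0) (f 1) (f 2) (hf (by decide)) (hf (by decide))
        ⟨(hσ 0 1).2 (by simp [p123]), (hσ 0 2).2 (by simp [p123])⟩

lemma pContains_g122_iff (π : Perm (Fin n)) : PContains π g122 ↔ Has643521 π := by
  have hg : ∀ i, g122 i = ![5, 3, 2, 4, 1, 0] i := fun _ => rfl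
  constructor
  · rintro ⟨f, hf, hσ⟩
    simp only [hg] at hσ
    exact ⟨f 0, f 1, f 2, f 3, f 4, f 5, hf (by decide), hf (by decide), hf (by decide),
      hf (by decide), hf (by decide), (hσ _ _).2 (by decide), (hσ _ _).2 (by decide),
      (hσ _ _).2 (by decide), (hσ _ _).2 (by decide), (hσ _ _).2 (by decide)⟩
  · rintro ⟨z, a, b, c, d, e, h1, h2, h3, h4, h5, g1, g2, g3, g4, g5⟩
    refine ⟨![z, a, b, c, d, e], ?_, ?_⟩
    · rw [Fin.strictMono_iff_lt_succ]
      simp [Fin.forall_fin_succ, h1, h2, h3, h4, h5]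
    · have hmono : StrictMono ![π e, π d, π b, π a, π c, π z] := by
        rw [Fin.strictMono_iff_lt_succ]
        simp [Fin.forall_fin_succ, g1, g2, g3, g4, g5]
      have hval : ∀ s, π (![z, a, b, c, d, e] s) = ![π e, π d, π b, π a, π c, π z] (g122 s) := by
        intro s
        rw [hg]
        fin_cases s <;> rfl
      intro s t
      rw [hval, hval, hmono.lt_iff_lt]

end patterns

/-- For `n ≥ 3`, `|S_n(132, 123, γ_{1,2,2})| = F_{n+3} + F_{n+1} - 3n + 2`. -/
theorem statement9 (n : ℕ) (hn : 3 ≤ n) :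
    (Nat.card {π : Equiv.Perm (Fin n) //
        PAvoids π p132 ∧ PAvoids π p123 ∧ PAvoids π g122} : ℤ) =
      Nat.fib (n + 3) + Nat.fib (n + 1) - 3 * n + 2 := by
  obtain ⟨m, rfl⟩ := Nat.exists_eq_add_of_le' hn
  have hcard : Nat.card {π : Equiv.Perm (Fin (m + 3)) //
      PAvoids π p132 ∧ PAvoids π p123 ∧ PAvoids π g122} = cardAvoid643521 (m + 3) := by
    refine Nat.card_congr (Equiv.subtypeEquivRight fun π => ?_)
    rw [← and_assoc, pAvoids_p132_and_p123_iff, PAvoids, pContains_g122_iff]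
  have h := cardAvoid643521_add_three_eq m
  rw [hcard]
  zify at h
  push_cast
  linarith
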